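/- There are no totally umbilical surfaces in a BCV space M³(κ,τ) with τ ≠ 0 and κ ≠ 4τ²; equivalently, the only BCV spaces with κ ≠ 4τ² admitting totally umbilical surfaces are the products S²(κ)×ℝ (κ>0, τ=0) and H²(κ)×ℝ (κ<0, τ=0). -/

import Mathlib

open Matrix

/-- The conformal factor F = 1 + (κ/4)(x²+y²). -/
noncomputable def bcvF (κ : ℝ) (p : Fin 3 → ℝ) : ℝ := 1 + κ/4 * ((p 0)^2 + (p 1)^2)

/-- The BCV metric as a pointwise bilinear form. -/
noncomputable def bcvMetric (κ τ : ℝ) (p : Fin 3 → ℝ) (u v : Fin 3 → ℝ) : ℝ :=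
  (u 0 * v 0 + u 1 * v 1) / (bcvF κ p)^2
    + (u 2 + τ * (p 1 * u 0 - p 0 * u 1) / bcvF κ p)
      * (v 2 + τ * (p 1 * v 0 - p 0 * v 1) / bcvF κ p)

/-- The matrix of the BCV metric in the coordinate basis. -/
noncomputable def bcvG (κ τ : ℝ) (p : Fin 3 → ℝ) : Matrix (Fin 3) (Fin 3) ℝ :=
  Matrix.of fun i j => bcvMetric κ τ p (Pi.single i 1) (Pi.single j 1)

/-- The Christoffel symbols Γ^k_{ij} of the BCV metric. -/
noncomputable def bcvGamma (κ τ : ℝ) (p : Fin 3 → ℝ) (k i j : Fin 3) : ℝ :=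
  (1/2) * ∑ l : Fin 3, (bcvG κ τ p)⁻¹ k l *
    (fderiv ℝ (fun q => bcvG κ τ q j l) p (Pi.single i 1)
      + fderiv ℝ (fun q => bcvG κ τ q i l) p (Pi.single j 1)
      - fderiv ℝ (fun q => bcvG κ τ q i j) p (Pi.single l 1))

/-- The covariant derivative (for the BCV Levi-Civita connection) of a vector field W
along a map F : ℝ² → ℝ³, in the direction v ∈ ℝ². -/
noncomputable def bcvCovDeriv (κ τ : ℝ) (F W : (Fin 2 → ℝ) → (Fin 3 → ℝ))
    (p : Fin 2 → ℝ) (v : Fin 2 → ℝ) : Fin 3 → ℝ :=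
  fderiv ℝ W p v + fun k =>
    ∑ i : Fin 3, ∑ j : Fin 3, bcvGamma κ τ (F p) k i j * fderiv ℝ F p v i * W p j


namespace BCVProof

abbrev E2 := Fin 2 → ℝ

/-- Directional derivative. -/
noncomputable def D (w : E2) (h : E2 → ℝ) (p : E2) : ℝ := fderiv ℝ h p w

variable {w : E2} {p : E2} {f g : E2 → ℝ}

lemma D_add (hf : DifferentiableAt ℝ f p) (hg : DifferentiableAt ℝ g p) :
    D w (fun q => f q + g q) p = D w f p + D w g p := by
  unfold D; rw [fderiv_fun_add hf hg]; rfl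

lemma D_sub (hf : DifferentiableAt ℝ f p) (hg : DifferentiableAt ℝ g p) :
    D w (fun q => f q - g q) p = D w f p - D w g p := by
  unfold D; rw [fderiv_fun_sub hf hg]; rfl

lemma D_mul (hf : DifferentiableAt ℝ f p) (hg : DifferentiableAt ℝ g p) :
    D w (fun q => f q * g q) p = f p * D w g p + g p * D w f p := by
  unfold D; rw [fderiv_fun_mul hf hg]; rfl

lemma D_neg : D w (fun q => - f q) p = - D w f p := by
  unfold D; rw [fderiv_fun_neg]; rfl

lemma D_const (c : ℝ) : D w (fun _ => c) p = 0 := by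
  unfold D; simp

lemma D_congr {U : Set E2} (hU : IsOpen U) (hp : p ∈ U) (h : ∀ q ∈ U, f q = g q) :
    D w f p = D w g p := by
  unfold D
  have : f =ᶠ[nhds p] g := Filter.eventually_of_mem (hU.mem_nhds hp) h
  rw [this.fderiv_eq]

lemma D_smooth {U : Set E2} (hU : IsOpen U) (hf : ContDiffOn ℝ (⊤ : ℕ∞) f U) :
    ContDiffOn ℝ (⊤ : ℕ∞) (D w f) U := by
  have h1 : ContDiffOn ℝ (⊤ : ℕ∞) (fderiv ℝ f) U := hf.fderiv_of_isOpen hU (by simp)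
  exact h1.clm_apply contDiffOn_const

lemma D_swap {U : Set E2} (hU : IsOpen U) (hf : ContDiffOn ℝ (⊤ : ℕ∞) f U) (hp : p ∈ U)
    (v w : E2) : D v (D w f) p = D w (D v f) p := by
  have hc : ContDiffAt ℝ (⊤ : ℕ∞) f p := hf.contDiffAt (hU.mem_nhds hp)
  have hs : IsSymmSndFDerivAt ℝ f p := by
    apply hc.isSymmSndFDerivAt
    simp [minSmoothness_of_isRCLikeNormedField]
    exact WithTop.coe_le_coe.mpr (le_top : ((2:ℕ∞)) ≤ ⊤)
  have hd : DifferentiableAt ℝ (fderiv ℝ f) p := by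
    have h1 : ContDiffOn ℝ (⊤ : ℕ∞) (fderiv ℝ f) U := hf.fderiv_of_isOpen hU (by simp)
    exact (h1.contDiffAt (hU.mem_nhds hp)).differentiableAt (by simp)
  have key : ∀ v w : E2, D v (D w f) p = fderiv ℝ (fderiv ℝ f) p v w := by
    intro v w
    have : D w f = fun q => (fderiv ℝ f q) w := rfl
    unfold D
    rw [fderiv_clm_apply hd (by fun_prop)]
    simp
  rw [key, key]; exact hs v w

lemma sm_diff {U : Set E2} (hU : IsOpen U) (hf : ContDiffOn ℝ (⊤ : ℕ∞) f U) (hp : p ∈ U) :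
    DifferentiableAt ℝ f p :=
  (hf.contDiffAt (hU.mem_nhds hp)).differentiableAt (by simp)

set_option maxHeartbeats 4000000 in
/-- The frame version of the theorem. -/
theorem core (κ τ : ℝ) (hτ : τ ≠ 0) (hκτ : κ ≠ 4 * τ^2) (U : Set E2) (hU : IsOpen U)
    (hne : U.Nonempty) (e d : E2) (x y z n1 n2 n3 a1 a2 a3 b1 b2 b3 l : E2 → ℝ)
    (hx : ContDiffOn ℝ (⊤ : ℕ∞) x U) (hy : ContDiffOn ℝ (⊤ : ℕ∞) y U)
    (hz : ContDiffOn ℝ (⊤ : ℕ∞) z U)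
    (hn1 : ContDiffOn ℝ (⊤ : ℕ∞) n1 U) (hn2 : ContDiffOn ℝ (⊤ : ℕ∞) n2 U)
    (hn3 : ContDiffOn ℝ (⊤ : ℕ∞) n3 U)
    (ha1 : ContDiffOn ℝ (⊤ : ℕ∞) a1 U) (ha2 : ContDiffOn ℝ (⊤ : ℕ∞) a2 U)
    (ha3 : ContDiffOn ℝ (⊤ : ℕ∞) a3 U)
    (hb1 : ContDiffOn ℝ (⊤ : ℕ∞) b1 U) (hb2 : ContDiffOn ℝ (⊤ : ℕ∞) b2 U)
    (hb3 : ContDiffOn ℝ (⊤ : ℕ∞) b3 U)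
    (hl : ContDiffOn ℝ (⊤ : ℕ∞) l U)
    (hf : ∀ p ∈ U, 1 + κ/4 * (x p * x p + y p * y p) ≠ 0)
    (xu : ∀ p ∈ U, D e x p = (1 + κ/4 * (x p * x p + y p * y p)) * a1 p)
    (xv : ∀ p ∈ U, D d x p = (1 + κ/4 * (x p * x p + y p * y p)) * b1 p)
    (yu : ∀ p ∈ U, D e y p = (1 + κ/4 * (x p * x p + y p * y p)) * a2 p)
    (yv : ∀ p ∈ U, D d y p = (1 + κ/4 * (x p * x p + y p * y p)) * b2 p)
    (zu : ∀ p ∈ U, D e z p = a3 p - τ * (y p * a1 p - x p * a2 p))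
    (zv : ∀ p ∈ U, D d z p = b3 p - τ * (y p * b1 p - x p * b2 p))
    (n1u : ∀ p ∈ U, D e n1 p = - (l p * a1 p)
      - n2 p * (-(κ/2 * (y p * a1 p)) + κ/2 * (x p * a2 p) + τ * a3 p) - τ * (n3 p * a2 p))
    (n1v : ∀ p ∈ U, D d n1 p = - (l p * b1 p)
      - n2 p * (-(κ/2 * (y p * b1 p)) + κ/2 * (x p * b2 p) + τ * b3 p) - τ * (n3 p * b2 p))
    (n2u : ∀ p ∈ U, D e n2 p = - (l p * a2 p)
      + n1 p * (-(κ/2 * (y p * a1 p)) + κ/2 * (x p * a2 p) + τ * a3 p) + τ * (n3 p * a1 p))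
    (n2v : ∀ p ∈ U, D d n2 p = - (l p * b2 p)
      + n1 p * (-(κ/2 * (y p * b1 p)) + κ/2 * (x p * b2 p) + τ * b3 p) + τ * (n3 p * b1 p))
    (n3u : ∀ p ∈ U, D e n3 p = - (l p * a3 p) + τ * (n1 p * a2 p - n2 p * a1 p))
    (n3v : ∀ p ∈ U, D d n3 p = - (l p * b3 p) + τ * (n1 p * b2 p - n2 p * b1 p))
    (hnn : ∀ p ∈ U, n1 p * n1 p + n2 p * n2 p + n3 p * n3 p = 1)
    (han : ∀ p ∈ U, n1 p * a1 p + n2 p * a2 p + n3 p * a3 p = 0)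
    (hbn : ∀ p ∈ U, n1 p * b1 p + n2 p * b2 p + n3 p * b3 p = 0)
    (hab : ∀ p ∈ U, ¬ (a2 p * b3 p - a3 p * b2 p = 0 ∧ a3 p * b1 p - a1 p * b3 p = 0 ∧
      a1 p * b2 p - a2 p * b1 p = 0)) : False := by
  have hc : κ - 4 * τ^2 ≠ 0 := sub_ne_zero.mpr hκτ
  -- structure equations
  have S : ∀ p ∈ U,
      D d a1 p - D e b1 p = κ/2 * y p * (a2 p * b1 p - a1 p * b2 p) ∧
      D d a2 p - D e b2 p = κ/2 * x p * (a1 p * b2 p - a2 p * b1 p) ∧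
      D d a3 p - D e b3 p = 2 * τ * (a1 p * b2 p - a2 p * b1 p) := by
    intro p hp
    have dx := sm_diff hU hx hp
    have dy := sm_diff hU hy hp
    have da1 := sm_diff hU ha1 hp
    have da2 := sm_diff hU ha2 hp
    have da3 := sm_diff hU ha3 hp
    have db1 := sm_diff hU hb1 hp
    have db2 := sm_diff hU hb2 hp
    have db3 := sm_diff hU hb3 hp
    have ex := D_swap hU hx hp d e
    have ey := D_swap hU hy hp d e
    have ez := D_swap hU hz hp d e
    rw [D_congr hU hp xu, D_congr hU hp xv] at ex
    rw [D_congr hU hp yu, D_congr hU hp yv] at ey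
    rw [D_congr hU hp zu, D_congr hU hp zv] at ez
    simp (disch := fun_prop) only [D_add, D_sub, D_mul, D_neg, D_const] at ex ey ez
    rw [xu p hp, xv p hp, yu p hp, yv p hp] at ex ey ez
    have h1 : D d a1 p - D e b1 p = κ/2 * y p * (a2 p * b1 p - a1 p * b2 p) := by
      apply mul_left_cancel₀ (hf p hp)
      linear_combination ex
    have h2 : D d a2 p - D e b2 p = κ/2 * x p * (a1 p * b2 p - a2 p * b1 p) := by
      apply mul_left_cancel₀ (hf p hp)
      linear_combination ey
    refine ⟨h1, h2, ?_⟩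
    linear_combination ez + τ * y p * h1 - τ * x p * h2
  -- Codazzi
  have C : ∀ p ∈ U, D e l p = -((κ - 4 * τ^2) * (n3 p * a3 p)) ∧
      D d l p = -((κ - 4 * τ^2) * (n3 p * b3 p)) := by
    intro p hp
    have dx := sm_diff hU hx hp
    have dy := sm_diff hU hy hp
    have da1 := sm_diff hU ha1 hp
    have da2 := sm_diff hU ha2 hp
    have da3 := sm_diff hU ha3 hp
    have db1 := sm_diff hU hb1 hp
    have db2 := sm_diff hU hb2 hp
    have db3 := sm_diff hU hb3 hp
    have dn1 := sm_diff hU hn1 hp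
    have dn2 := sm_diff hU hn2 hp
    have dn3 := sm_diff hU hn3 hp
    have dl := sm_diff hU hl hp
    obtain ⟨s1, s2, s3⟩ := S p hp
    have e1 := D_swap hU hn1 hp d e
    have e2 := D_swap hU hn2 hp d e
    have e3 := D_swap hU hn3 hp d e
    rw [D_congr hU hp n1u, D_congr hU hp n1v] at e1
    rw [D_congr hU hp n2u, D_congr hU hp n2v] at e2
    rw [D_congr hU hp n3u, D_congr hU hp n3v] at e3
    simp (disch := fun_prop) only [D_add, D_sub, D_mul, D_neg, D_const] at e1 e2 e3
    rw [xu p hp, xv p hp, yu p hp, yv p hp, n2u p hp, n2v p hp, n3u p hp, n3v p hp] at e1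
    rw [xu p hp, xv p hp, yu p hp, yv p hp, n1u p hp, n1v p hp, n3u p hp, n3v p hp] at e2
    rw [n1u p hp, n1v p hp, n2u p hp, n2v p hp] at e3
    rw [sub_eq_iff_eq_add.mp s1, sub_eq_iff_eq_add.mp s2, sub_eq_iff_eq_add.mp s3] at e1 e2 e3
    have A := han p hp
    have B := hbn p hp
    have nn := hnn p hp
    have hx' := hab p hp
    generalize D e l p = lu at *
    generalize D d l p = lv at *
    have t1 : (lv + (κ - 4 * τ^2) * (n3 p * b3 p)) * a1 p
        - (lu + (κ - 4 * τ^2) * (n3 p * a3 p)) * b1 p = 0 := by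
      linear_combination -e1 + (κ - 3 * τ^2) * (a1 p * B - b1 p * A)
    have t2 : (lv + (κ - 4 * τ^2) * (n3 p * b3 p)) * a2 p
        - (lu + (κ - 4 * τ^2) * (n3 p * a3 p)) * b2 p = 0 := by
      linear_combination -e2 + (κ - 3 * τ^2) * (a2 p * B - b2 p * A)
    have t3 : (lv + (κ - 4 * τ^2) * (n3 p * b3 p)) * a3 p
        - (lu + (κ - 4 * τ^2) * (n3 p * a3 p)) * b3 p = 0 := by
      linear_combination -e3 - τ^2 * (b3 p * A - a3 p * B)
    generalize hP : lv + (κ - 4 * τ^2) * (n3 p * b3 p) = P at t1 t2 t3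
    generalize hQ : lu + (κ - 4 * τ^2) * (n3 p * a3 p) = Q at t1 t2 t3
    have P0 : P = 0 := by
      by_contra h
      apply hx'
      refine ⟨mul_left_cancel₀ h ?_, mul_left_cancel₀ h ?_, mul_left_cancel₀ h ?_⟩
      · linear_combination b3 p * t2 - b2 p * t3
      · linear_combination b1 p * t3 - b3 p * t1
      · linear_combination b2 p * t1 - b1 p * t2
    have Q0 : Q = 0 := by
      by_contra h
      apply hx'
      refine ⟨mul_left_cancel₀ h ?_, mul_left_cancel₀ h ?_, mul_left_cancel₀ h ?_⟩
      · linear_combination a3 p * t2 - a2 p * t3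
      · linear_combination a1 p * t3 - a3 p * t1
      · linear_combination a2 p * t1 - a1 p * t2
    constructor
    · linear_combination hQ + Q0
    · linear_combination hP + P0
  -- cross product
  have M : ∀ p ∈ U, ∃ m : ℝ, m ≠ 0 ∧ a2 p * b3 p - a3 p * b2 p = m * n1 p ∧
      a3 p * b1 p - a1 p * b3 p = m * n2 p ∧ a1 p * b2 p - a2 p * b1 p = m * n3 p := by
    intro p hp
    have A := han p hp
    have B := hbn p hp
    have nn := hnn p hp
    have hx' := hab p hp
    let m := (a2 p * b3 p - a3 p * b2 p) * n1 p + (a3 p * b1 p - a1 p * b3 p) * n2 p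
      + (a1 p * b2 p - a2 p * b1 p) * n3 p
    have h1 : a2 p * b3 p - a3 p * b2 p = m * n1 p := by
      simp only [m]
      linear_combination (-(a2 p * b3 p - a3 p * b2 p)) * nn
        + (n2 p * b3 p - n3 p * b2 p) * A - (n2 p * a3 p - n3 p * a2 p) * B
    have h2 : a3 p * b1 p - a1 p * b3 p = m * n2 p := by
      simp only [m]
      linear_combination (-(a3 p * b1 p - a1 p * b3 p)) * nn
        + (n3 p * b1 p - n1 p * b3 p) * A - (n3 p * a1 p - n1 p * a3 p) * B
    have h3 : a1 p * b2 p - a2 p * b1 p = m * n3 p := by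
      simp only [m]
      linear_combination (-(a1 p * b2 p - a2 p * b1 p)) * nn
        + (n1 p * b2 p - n2 p * b1 p) * A - (n1 p * a2 p - n2 p * a1 p) * B
    refine ⟨m, ?_, h1, h2, h3⟩
    intro h0
    apply hx'
    rw [h1, h2, h3, h0]; simp
  have K : ∀ p ∈ U, 3 * (n3 p * n3 p) = 1 := by
    intro p hp
    have da3 := sm_diff hU ha3 hp
    have db3 := sm_diff hU hb3 hp
    have dn3 := sm_diff hU hn3 hp
    obtain ⟨s1, s2, s3⟩ := S p hp
    obtain ⟨m, hm, h1, h2, h3⟩ := M p hp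
    have nn := hnn p hp
    have el := D_swap hU hl hp d e
    rw [D_congr hU hp (fun q hq => (C q hq).1), D_congr hU hp (fun q hq => (C q hq).2)] at el
    simp (disch := fun_prop) only [D_add, D_sub, D_mul, D_neg, D_const] at el
    rw [n3u p hp, n3v p hp, sub_eq_iff_eq_add.mp s3] at el
    have hz : (κ - 4 * τ^2) * (τ * m) ≠ 0 := mul_ne_zero hc (mul_ne_zero hτ hm)
    apply mul_left_cancel₀ hz
    linear_combination -el + (κ - 4 * τ^2) * (τ * m) * nn
      + (κ - 4 * τ^2) * τ * (n1 p * h1 + n2 p * h2 - 2 * n3 p * h3)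
  obtain ⟨p, hp⟩ := hne
  have dn3 := sm_diff hU hn3 hp
  have ku := D_congr (w := e) hU hp K
  have kv := D_congr (w := d) hU hp K
  simp (disch := fun_prop) only [D_mul, D_const] at ku kv
  have k := K p hp
  obtain ⟨m, hm, h1, h2, h3⟩ := M p hp
  have nn := hnn p hp
  have hn0 : n3 p ≠ 0 := by
    intro h; rw [h] at k; norm_num at k
  have u0 : D e n3 p = 0 := by
    apply mul_left_cancel₀ hn0; linear_combination ku / 6
  have v0 : D d n3 p = 0 := by
    apply mul_left_cancel₀ hn0; linear_combination kv / 6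
  rw [n3u p hp] at u0
  rw [n3v p hp] at v0
  have : τ * m = 0 := by
    linear_combination (3/2) * b3 p * u0 - (3/2) * a3 p * v0
      - (3/2) * τ * n1 p * h1 - (3/2) * τ * n2 p * h2 - (3/2) * τ * m * nn + (1/2) * τ * m * k
  exact mul_ne_zero hτ hm this

end BCVProof

namespace BCVProof

/-- Covector coefficients of the third coframe element. -/
noncomputable def tc (κ τ : ℝ) (q : Fin 3 → ℝ) : Fin 3 → ℝ :=
  ![τ * (q 1 * (bcvF κ q)⁻¹), -(τ * (q 0 * (bcvF κ q)⁻¹)), 1]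

/-- Derivative of the inverse conformal factor. -/
noncomputable def dr (κ : ℝ) (q : Fin 3 → ℝ) : Fin 3 → ℝ :=
  ![-(κ/2 * q 0 * (bcvF κ q)⁻¹ ^ 2), -(κ/2 * q 1 * (bcvF κ q)⁻¹ ^ 2), 0]

/-- Derivative of `tc`. -/
noncomputable def dtc (κ τ : ℝ) (q : Fin 3 → ℝ) (l : Fin 3) : Fin 3 → ℝ :=
  ![τ * (q 1 * dr κ q l + (bcvF κ q)⁻¹ * (Pi.single l 1 : Fin 3 → ℝ) 1),
    -(τ * (q 0 * dr κ q l + (bcvF κ q)⁻¹ * (Pi.single l 1 : Fin 3 → ℝ) 0)), 0]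

/-- Horizontal part indicator. -/
def hd : Fin 3 → Fin 3 → ℝ := ![![1, 0, 0], ![0, 1, 0], ![0, 0, 0]]

lemma G_eq (κ τ : ℝ) (q : Fin 3 → ℝ) (i j : Fin 3) :
    bcvG κ τ q i j = hd i j * ((bcvF κ q)⁻¹ * (bcvF κ q)⁻¹) + tc κ τ q i * tc κ τ q j := by
  fin_cases i <;> fin_cases j <;> simp [bcvG, bcvMetric, hd, tc, Pi.single_apply] <;> ring

lemma hasF (κ : ℝ) (p : Fin 3 → ℝ) : HasFDerivAt (bcvF κ)
    ((κ/4) • ((2 * p 0) • (ContinuousLinearMap.proj (R := ℝ) (φ := fun _ : Fin 3 => ℝ) 0)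
      + (2 * p 1) • (ContinuousLinearMap.proj (R := ℝ) (φ := fun _ : Fin 3 => ℝ) 1))) p := by
  have h0 : HasFDerivAt (fun q : Fin 3 → ℝ => q 0)
    (ContinuousLinearMap.proj (R := ℝ) (φ := fun _ : Fin 3 => ℝ) 0) p := hasFDerivAt_apply 0 p
  have h1 : HasFDerivAt (fun q : Fin 3 → ℝ => q 1)
    (ContinuousLinearMap.proj (R := ℝ) (φ := fun _ : Fin 3 => ℝ) 1) p := hasFDerivAt_apply 1 p
  have := (((h0.pow 2).add (h1.pow 2)).const_mul (κ/4)).const_add 1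
  refine this.congr_fderiv ?_
  ext v; simp

lemma hasR (κ : ℝ) (p : Fin 3 → ℝ) (hf : bcvF κ p ≠ 0) :
    HasFDerivAt (fun q => (bcvF κ q)⁻¹) (-(bcvF κ p ^ 2)⁻¹ •
    ((κ/4) • ((2 * p 0) • (ContinuousLinearMap.proj (R := ℝ) (φ := fun _ : Fin 3 => ℝ) 0)
      + (2 * p 1) • (ContinuousLinearMap.proj (R := ℝ) (φ := fun _ : Fin 3 => ℝ) 1)))) p :=
  (hasDerivAt_inv hf).comp_hasFDerivAt p (hasF κ p)

lemma r_deriv (κ : ℝ) (p : Fin 3 → ℝ) (hf : bcvF κ p ≠ 0) (l : Fin 3) :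
    fderiv ℝ (fun q => (bcvF κ q)⁻¹) p (Pi.single l 1) = dr κ p l := by
  rw [(hasR κ p hf).fderiv]
  fin_cases l <;> simp [dr, Pi.single_apply] <;> ring

lemma r_diff (κ : ℝ) (p : Fin 3 → ℝ) (hf : bcvF κ p ≠ 0) :
    DifferentiableAt ℝ (fun q => (bcvF κ q)⁻¹) p := (hasR κ p hf).differentiableAt

lemma tc_deriv (κ τ : ℝ) (p : Fin 3 → ℝ) (hf : bcvF κ p ≠ 0) (i : Fin 3) :
    ∃ L : (Fin 3 → ℝ) →L[ℝ] ℝ, HasFDerivAt (fun q => tc κ τ q i) L p ∧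
      ∀ l, L (Pi.single l 1) = dtc κ τ p l i := by
  have hr := (r_diff κ p hf).hasFDerivAt
  have h0 : HasFDerivAt (fun q : Fin 3 → ℝ => q 0)
    (ContinuousLinearMap.proj (R := ℝ) (φ := fun _ : Fin 3 => ℝ) 0) p := hasFDerivAt_apply 0 p
  have h1 : HasFDerivAt (fun q : Fin 3 → ℝ => q 1)
    (ContinuousLinearMap.proj (R := ℝ) (φ := fun _ : Fin 3 => ℝ) 1) p := hasFDerivAt_apply 1 p
  fin_cases i
  · refine ⟨_, (h1.mul hr).const_mul τ, fun l => ?_⟩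
    simp [r_deriv κ p hf, dtc]
    ring
  · refine ⟨_, ((h0.mul hr).const_mul τ).neg, fun l => ?_⟩
    simp [r_deriv κ p hf, dtc]
    ring
  · refine ⟨_, hasFDerivAt_const (1:ℝ) p, fun l => ?_⟩
    simp [dtc]

lemma G_deriv (κ τ : ℝ) (p : Fin 3 → ℝ) (hf : bcvF κ p ≠ 0) (i j l : Fin 3) :
    fderiv ℝ (fun q => bcvG κ τ q i j) p (Pi.single l 1) =
      hd i j * (2 * (bcvF κ p)⁻¹ * dr κ p l) + tc κ τ p i * dtc κ τ p l j
        + dtc κ τ p l i * tc κ τ p j := by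
  have e : (fun q => bcvG κ τ q i j) = fun q => hd i j * ((bcvF κ q)⁻¹ * (bcvF κ q)⁻¹)
    + tc κ τ q i * tc κ τ q j := by
    funext q; exact G_eq κ τ q i j
  obtain ⟨L, hL, hL'⟩ := tc_deriv κ τ p hf i
  obtain ⟨M, hM, hM'⟩ := tc_deriv κ τ p hf j
  have hr := (r_diff κ p hf).hasFDerivAt
  have key := (((hr.mul hr).const_mul (hd i j)).add (hL.mul hM)).fderiv
  rw [e]
  refine (congrArg (fun T : (Fin 3 → ℝ) →L[ℝ] ℝ => T (Pi.single l 1)) key).trans ?_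
  simp [hL', hM', r_deriv κ p hf]
  ring

/-- Explicit inverse metric. -/
noncomputable def gi (κ τ : ℝ) (p : Fin 3 → ℝ) : Matrix (Fin 3) (Fin 3) ℝ :=
  !![bcvF κ p ^ 2, 0, -(bcvF κ p * τ * p 1);
     0, bcvF κ p ^ 2, bcvF κ p * τ * p 0;
     -(bcvF κ p * τ * p 1), bcvF κ p * τ * p 0, τ^2 * (p 0 ^ 2 + p 1 ^ 2) + 1]

lemma G_inv (κ τ : ℝ) (p : Fin 3 → ℝ) (hf : bcvF κ p ≠ 0) : (bcvG κ τ p)⁻¹ = gi κ τ p := by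
  apply Matrix.inv_eq_right_inv
  ext i j
  rw [Matrix.mul_apply, Fin.sum_univ_three, G_eq, G_eq, G_eq]
  fin_cases i <;> fin_cases j <;> simp [gi, hd, tc] <;> field_simp <;> ring

lemma Gam (κ τ : ℝ) (p : Fin 3 → ℝ) (hf : bcvF κ p ≠ 0) (u w : Fin 3 → ℝ) (f r x y : ℝ)
    (hff : f = bcvF κ p) (hr : r = f⁻¹) (hx : x = p 0) (hy : y = p 1)
    (n1 n2 n3 X1 X2 X3 : ℝ)
    (hn1 : n1 = w 0 * r) (hn2 : n2 = w 1 * r) (hn3 : n3 = w 2 + τ * (y * w 0 - x * w 1) * r)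
    (hX1 : X1 = u 0 * r) (hX2 : X2 = u 1 * r) (hX3 : X3 = u 2 + τ * (y * u 0 - x * u 1) * r) :
    let C := fun k => ∑ i : Fin 3, ∑ j : Fin 3, bcvGamma κ τ p k i j * u i * w j
    let rho := -(κ/2) * (x * X1 + y * X2)
    r * C 0 = rho * n1 + n2 * (-(κ/2 * (y * X1)) + κ/2 * (x * X2) + τ * X3) + τ * (n3 * X2) ∧
    r * C 1 = rho * n2 - n1 * (-(κ/2 * (y * X1)) + κ/2 * (x * X2) + τ * X3) - τ * (n3 * X1) ∧
    C 2 + τ * (y * (r * C 0) - x * (r * C 1)) =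
      τ * ((u 1 + y * rho) * n1 - (u 0 + x * rho) * n2) - τ * (n1 * X2 - n2 * X1) := by
  intro C rho
  have hF : f = 1 + κ/4 * (x^2 + y^2) := by rw [hff, hx, hy]; rfl
  have hf0 : f ≠ 0 := by rw [hff]; exact hf
  simp only [C, rho, bcvGamma, G_inv κ τ p hf, G_deriv κ τ p hf, Fin.sum_univ_three]
  simp [gi, hd, tc, dtc, dr, Pi.single_apply, ← hff, ← hx, ← hy, hn1, hn2, hn3, hX1, hX2, hX3, hr]
  refine ⟨?_, ?_, ?_⟩
  · field_simp
    rw [hF]; ring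
  · field_simp
    rw [hF]; ring
  · field_simp
    rw [hF]; ring

end BCVProof

namespace BCVProof

lemma D_comp {F : E2 → (Fin 3 → ℝ)} {p : E2} (h : DifferentiableAt ℝ F p) (w : E2) (i : Fin 3) :
    D w (fun q => F q i) p = fderiv ℝ F p w i := by
  unfold D
  have := (hasFDerivAt_pi'.mp h.hasFDerivAt i).fderiv
  rw [this]; rfl

lemma frame_eq (κ τ : ℝ) (U : Set E2) (hU : IsOpen U) (F ξ : E2 → (Fin 3 → ℝ)) (lam : E2 → ℝ)
    (hF : ContDiffOn ℝ (⊤ : ℕ∞) F U) (hξ : ContDiffOn ℝ (⊤ : ℕ∞) ξ U)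
    (hpos : ∀ p ∈ U, bcvF κ (F p) > 0)
    (r n1 n2 n3 : E2 → ℝ)
    (hr : r = fun p => (bcvF κ (F p))⁻¹)
    (hn1 : n1 = fun p => ξ p 0 * r p) (hn2 : n2 = fun p => ξ p 1 * r p)
    (hn3 : n3 = fun p => ξ p 2 + τ * ((F p 1 * ξ p 0 - F p 0 * ξ p 1) * r p))
    (w : E2) (a1 a2 a3 : E2 → ℝ)
    (ha1 : a1 = fun p => D w (fun q => F q 0) p * r p)
    (ha2 : a2 = fun p => D w (fun q => F q 1) p * r p)
    (ha3 : a3 = fun p => D w (fun q => F q 2) p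
      + τ * ((F p 1 * D w (fun q => F q 0) p - F p 0 * D w (fun q => F q 1) p) * r p))
    (hum : ∀ p ∈ U, ∀ v : E2, bcvCovDeriv κ τ F ξ p v = (-(lam p)) • fderiv ℝ F p v) :
    ∀ p ∈ U, D w n1 p = - (lam p * a1 p)
      - n2 p * (-(κ/2 * (F p 1 * a1 p)) + κ/2 * (F p 0 * a2 p) + τ * a3 p) - τ * (n3 p * a2 p) ∧
      D w n2 p = - (lam p * a2 p)
      + n1 p * (-(κ/2 * (F p 1 * a1 p)) + κ/2 * (F p 0 * a2 p) + τ * a3 p) + τ * (n3 p * a1 p) ∧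
      D w n3 p = - (lam p * a3 p) + τ * (n1 p * a2 p - n2 p * a1 p) := by
  intro p hp
  have hne := (hpos p hp).ne'
  have dF : DifferentiableAt ℝ F p :=
    (hF.contDiffAt (hU.mem_nhds hp)).differentiableAt (by simp)
  have dξ : DifferentiableAt ℝ ξ p :=
    (hξ.contDiffAt (hU.mem_nhds hp)).differentiableAt (by simp)
  have dF' : ∀ i, DifferentiableAt ℝ (fun q => F q i) p := differentiableAt_pi.mp dF
  have dξ' : ∀ i, DifferentiableAt ℝ (fun q => ξ q i) p := differentiableAt_pi.mp dξ
  have x0 := dF' 0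
  have x1 := dF' 1
  have z0 := dξ' 0
  have z1 := dξ' 1
  have z2 := dξ' 2
  have dr : DifferentiableAt ℝ r p := by
    rw [hr]
    exact (r_diff κ (F p) hne).comp p dF
  -- derivative of r
  have Dr : D w r p = -(κ/2) * (F p 0 * a1 p + F p 1 * a2 p) * r p := by
    have e : ∀ q ∈ U, r q * (1 + κ/4 * (F q 0 * F q 0 + F q 1 * F q 1)) = 1 := by
      intro q hq
      have h := (hpos q hq).ne'
      have : bcvF κ (F q) = 1 + κ/4 * (F q 0 * F q 0 + F q 1 * F q 1) := by
        unfold bcvF; ring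
      rw [hr, ← this]; exact inv_mul_cancel₀ h
    have h := D_congr (w := w) hU hp e
    simp (disch := fun_prop) only [D_mul, D_add, D_const] at h
    have e' := e p hp
    rw [ha1, ha2]
    simp only
    linear_combination r p * h - D w r p * e'
  have u := hum p hp w
  have G := Gam κ τ (F p) hne (fderiv ℝ F p w) (ξ p) _ (r p) _ _ rfl (by rw [hr]) rfl rfl
    (n1 p) (n2 p) (n3 p) (a1 p) (a2 p) (a3 p) (by rw [hn1]) (by rw [hn2])
    (by rw [hn3]; ring) (by rw [ha1]; simp only [D_comp dF]) (by rw [ha2]; simp only [D_comp dF])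
    (by rw [ha3]; simp only [D_comp dF]; ring)
  have u0 := congrFun u 0
  have u1 := congrFun u 1
  have u2 := congrFun u 2
  simp only [bcvCovDeriv, Pi.add_apply, Pi.smul_apply, smul_eq_mul, ← D_comp dξ, ← D_comp dF]
    at u0 u1 u2 G
  obtain ⟨G1, G2, G3⟩ := G
  generalize (∑ i : Fin 3, ∑ j : Fin 3, bcvGamma κ τ (F p) 0 i j *
    D w (fun q => F q i) p * ξ p j) = C0 at *
  generalize (∑ i : Fin 3, ∑ j : Fin 3, bcvGamma κ τ (F p) 1 i j *
    D w (fun q => F q i) p * ξ p j) = C1 at *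
  generalize (∑ i : Fin 3, ∑ j : Fin 3, bcvGamma κ τ (F p) 2 i j *
    D w (fun q => F q i) p * ξ p j) = C2 at *
  have A1 : a1 p = D w (fun q => F q 0) p * r p := by rw [ha1]
  have A2 : a2 p = D w (fun q => F q 1) p * r p := by rw [ha2]
  have A3 : a3 p = D w (fun q => F q 2) p
      + τ * ((F p 1 * D w (fun q => F q 0) p - F p 0 * D w (fun q => F q 1) p) * r p) := by
    rw [ha3]
  have N1 : n1 p = ξ p 0 * r p := by rw [hn1]
  have N2 : n2 p = ξ p 1 * r p := by rw [hn2]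
  have DN1 : D w n1 p = ξ p 0 * D w r p + r p * D w (fun q => ξ q 0) p := by
    rw [hn1]; exact D_mul z0 dr
  have DN2 : D w n2 p = ξ p 1 * D w r p + r p * D w (fun q => ξ q 1) p := by
    rw [hn2]; exact D_mul z1 dr
  have DN3 : D w n3 p = D w (fun q => ξ q 2) p
      + τ * ((F p 1 * ξ p 0 - F p 0 * ξ p 1) * D w r p
        + r p * (F p 1 * D w (fun q => ξ q 0) p + ξ p 0 * D w (fun q => F q 1) p
          - (F p 0 * D w (fun q => ξ q 1) p + ξ p 1 * D w (fun q => F q 0) p))) := by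
    rw [hn3]
    simp (disch := fun_prop) only [D_mul, D_add, D_sub, D_const]
    ring
  generalize D w r p = R at *
  refine ⟨?_, ?_, ?_⟩
  · rw [DN1, Dr]
    linear_combination r p * u0 - G1 - lam p * (-1) * A1 +
      (κ/2) * (F p 0 * a1 p + F p 1 * a2 p) * N1
  · rw [DN2, Dr]
    linear_combination r p * u1 - G2 - lam p * (-1) * A2 +
      (κ/2) * (F p 0 * a1 p + F p 1 * a2 p) * N2
  · rw [DN3, Dr]
    linear_combination u2 - G3 + τ * F p 1 * r p * u0 - τ * F p 0 * r p * u1 + lam p * A3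
      - τ * (D w (fun q => F q 1) p + F p 1 * (-(κ/2) * (F p 0 * a1 p + F p 1 * a2 p))) * N1
      + τ * (D w (fun q => F q 0) p + F p 0 * (-(κ/2) * (F p 0 * a1 p + F p 1 * a2 p))) * N2

end BCVProof

/-- There is no totally umbilical surface in a BCV space M³(κ,τ) with τ ≠ 0 and
κ ≠ 4τ²: no immersion F of an open piece of ℝ² into the BCV domain admits a unit
normal ξ whose shape operator is a scalar multiple of the identity. -/
theorem no_totally_umbilical_surface (κ τ : ℝ) (hτ : τ ≠ 0) (hκτ : κ ≠ 4 * τ^2) :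
    ¬ ∃ (U : Set (Fin 2 → ℝ)) (F ξ : (Fin 2 → ℝ) → (Fin 3 → ℝ))
        (lam : (Fin 2 → ℝ) → ℝ),
      IsOpen U ∧ U.Nonempty
      ∧ ContDiffOn ℝ (⊤ : ℕ∞) F U ∧ ContDiffOn ℝ (⊤ : ℕ∞) ξ U
      ∧ (∀ p ∈ U, bcvF κ (F p) > 0)
      ∧ (∀ p ∈ U, Function.Injective (fderiv ℝ F p))
      ∧ (∀ p ∈ U, bcvMetric κ τ (F p) (ξ p) (ξ p) = 1)
      ∧ (∀ p ∈ U, ∀ v : Fin 2 → ℝ, bcvMetric κ τ (F p) (ξ p) (fderiv ℝ F p v) = 0)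
      ∧ (∀ p ∈ U, ∀ v : Fin 2 → ℝ,
          bcvCovDeriv κ τ F ξ p v = (-(lam p)) • fderiv ℝ F p v) := by
  rintro ⟨U, F, ξ, lam, hU, hne, hF, hξ, hpos, hinj, hnn, hnt, hum⟩
  let e : Fin 2 → ℝ := Pi.single 0 1
  let d : Fin 2 → ℝ := Pi.single 1 1
  let r : (Fin 2 → ℝ) → ℝ := fun p => (bcvF κ (F p))⁻¹
  let n1 : (Fin 2 → ℝ) → ℝ := fun p => ξ p 0 * r p
  let n2 : (Fin 2 → ℝ) → ℝ := fun p => ξ p 1 * r p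
  let n3 : (Fin 2 → ℝ) → ℝ :=
    fun p => ξ p 2 + τ * ((F p 1 * ξ p 0 - F p 0 * ξ p 1) * r p)
  let X (i : Fin 3) : (Fin 2 → ℝ) → ℝ := fun q => F q i
  let A1 (w : Fin 2 → ℝ) : (Fin 2 → ℝ) → ℝ := fun p => BCVProof.D w (fun q => F q 0) p * r p
  let A2 (w : Fin 2 → ℝ) : (Fin 2 → ℝ) → ℝ := fun p => BCVProof.D w (fun q => F q 1) p * r p
  let A3 (w : Fin 2 → ℝ) : (Fin 2 → ℝ) → ℝ := fun p => BCVProof.D w (fun q => F q 2) p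
      + τ * ((F p 1 * BCVProof.D w (fun q => F q 0) p
        - F p 0 * BCVProof.D w (fun q => F q 1) p) * r p)
  have dF : ∀ p ∈ U, DifferentiableAt ℝ F p := fun p hp =>
    (hF.contDiffAt (hU.mem_nhds hp)).differentiableAt (by simp)
  have fe := fun w => BCVProof.frame_eq κ τ U hU F ξ lam hF hξ hpos r n1 n2 n3 rfl rfl rfl rfl w
    (A1 w) (A2 w) (A3 w) rfl rfl rfl hum
  have sF : ∀ i, ContDiffOn ℝ (⊤ : ℕ∞) (fun q => F q i) U := contDiffOn_pi.mp hF
  have sξ : ∀ i, ContDiffOn ℝ (⊤ : ℕ∞) (fun q => ξ q i) U := contDiffOn_pi.mp hξ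
  have sr : ContDiffOn ℝ (⊤ : ℕ∞) r U := by
    have : ContDiffOn ℝ (⊤ : ℕ∞) (fun p => bcvF κ (F p)) U := by
      unfold bcvF
      exact contDiffOn_const.add (contDiffOn_const.mul (((sF 0).pow 2).add ((sF 1).pow 2)))
    exact this.inv (fun p hp => (hpos p hp).ne')
  have sD : ∀ w i, ContDiffOn ℝ (⊤ : ℕ∞) (fun p => BCVProof.D w (fun q => F q i) p) U :=
    fun w i => BCVProof.D_smooth hU (sF i)
  have s1 : ContDiffOn ℝ (⊤ : ℕ∞) n1 U := (sξ 0).mul sr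
  have s2 : ContDiffOn ℝ (⊤ : ℕ∞) n2 U := (sξ 1).mul sr
  have s3 : ContDiffOn ℝ (⊤ : ℕ∞) n3 U := (sξ 2).add (contDiffOn_const.mul
    ((((sF 1).mul (sξ 0)).sub ((sF 0).mul (sξ 1))).mul sr))
  have t1 : ∀ w, ContDiffOn ℝ (⊤ : ℕ∞) (A1 w) U := fun w => (sD w 0).mul sr
  have t2 : ∀ w, ContDiffOn ℝ (⊤ : ℕ∞) (A2 w) U := fun w => (sD w 1).mul sr
  have t3 : ∀ w, ContDiffOn ℝ (⊤ : ℕ∞) (A3 w) U := fun w => (sD w 2).add (contDiffOn_const.mul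
    ((((sF 1).mul (sD w 0)).sub ((sF 0).mul (sD w 1))).mul sr))
  have hfx : ∀ p, bcvF κ (F p) = 1 + κ/4 * (F p 0 * F p 0 + F p 1 * F p 1) := by
    intro p; unfold bcvF; ring
  have hr1 : ∀ p ∈ U, bcvF κ (F p) * r p = 1 := fun p hp => mul_inv_cancel₀ (hpos p hp).ne'
  have hx : ∀ w, ∀ p ∈ U, BCVProof.D w (fun q => F q 0) p
      = (1 + κ/4 * (F p 0 * F p 0 + F p 1 * F p 1)) * A1 w p := by
    intro w p hp
    rw [← hfx]; simp only [A1]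
    linear_combination (- BCVProof.D w (fun q => F q 0) p) * hr1 p hp
  have hy : ∀ w, ∀ p ∈ U, BCVProof.D w (fun q => F q 1) p
      = (1 + κ/4 * (F p 0 * F p 0 + F p 1 * F p 1)) * A2 w p := by
    intro w p hp
    rw [← hfx]; simp only [A2]
    linear_combination (- BCVProof.D w (fun q => F q 1) p) * hr1 p hp
  have hz : ∀ w, ∀ p ∈ U, BCVProof.D w (fun q => F q 2) p
      = A3 w p - τ * (F p 1 * A1 w p - F p 0 * A2 w p) := by
    intro w p hp
    simp only [A1, A2, A3]; ring
  -- vanishing frame components force a vanishing vector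
  have hzero : ∀ (w : Fin 2 → ℝ), ∀ p ∈ U, A1 w p = 0 → A2 w p = 0 → A3 w p = 0 → w = 0 := by
    intro w p hp h1 h2 h3
    apply hinj p hp
    rw [map_zero]
    have k0 := hx w p hp
    have k1 := hy w p hp
    have k2 := hz w p hp
    rw [h1] at k0
    rw [h2] at k1
    rw [h1, h2, h3] at k2
    rw [BCVProof.D_comp (dF p hp)] at k0 k1 k2
    ext i
    fin_cases i
    · simpa using k0
    · simpa using k1
    · simpa using k2
  have haa : ∀ p ∈ U, A1 e p * A1 e p + A2 e p * A2 e p + A3 e p * A3 e p ≠ 0 := by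
    intro p hp h
    have h1 : A1 e p = 0 := by nlinarith [mul_self_nonneg (A1 e p), mul_self_nonneg (A2 e p), mul_self_nonneg (A3 e p)]
    have h2 : A2 e p = 0 := by nlinarith [mul_self_nonneg (A1 e p), mul_self_nonneg (A2 e p), mul_self_nonneg (A3 e p)]
    have h3 : A3 e p = 0 := by nlinarith [mul_self_nonneg (A1 e p), mul_self_nonneg (A2 e p), mul_self_nonneg (A3 e p)]
    have := congrFun (hzero e p hp h1 h2 h3) 0
    simp [e] at this
  have hDlin : ∀ (h : (Fin 2 → ℝ) → ℝ) (s t : ℝ) (p : Fin 2 → ℝ),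
      BCVProof.D (s • e - t • d) h p = s * BCVProof.D e h p - t * BCVProof.D d h p := by
    intro h s t p; simp [BCVProof.D]
  have hab : ∀ p ∈ U, ¬ (A2 e p * A3 d p - A3 e p * A2 d p = 0 ∧
      A3 e p * A1 d p - A1 e p * A3 d p = 0 ∧ A1 e p * A2 d p - A2 e p * A1 d p = 0) := by
    rintro p hp ⟨h1, h2, h3⟩
    set s := A1 e p * A1 d p + A2 e p * A2 d p + A3 e p * A3 d p with hs
    set t := A1 e p * A1 e p + A2 e p * A2 e p + A3 e p * A3 e p with ht
    have l1 : A1 (s • e - t • d) p = s * A1 e p - t * A1 d p := by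
      simp only [A1, hDlin]; ring
    have l2 : A2 (s • e - t • d) p = s * A2 e p - t * A2 d p := by
      simp only [A2, hDlin]; ring
    have l3 : A3 (s • e - t • d) p = s * A3 e p - t * A3 d p := by
      simp only [A3, hDlin]; ring
    have := congrFun (hzero (s • e - t • d) p hp
      (by rw [l1, hs, ht]; linear_combination A2 e p * h3 * 1 - A3 e p * h2)
      (by rw [l2, hs, ht]; linear_combination A3 e p * h1 - A1 e p * h3)
      (by rw [l3, hs, ht]; linear_combination A1 e p * h2 - A2 e p * h1)) 1
    simp [e, d] at this
    exact haa p hp this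
  have sl : ContDiffOn ℝ (⊤ : ℕ∞) lam U := by
    have q1 := BCVProof.D_smooth (w := e) hU s1
    have q2 := BCVProof.D_smooth (w := e) hU s2
    have q3 := BCVProof.D_smooth (w := e) hU s3
    have num : ContDiffOn ℝ (⊤ : ℕ∞) (fun p =>
        (A1 e p * BCVProof.D e n1 p + A2 e p * BCVProof.D e n2 p + A3 e p * BCVProof.D e n3 p)
        + (n2 p * A1 e p - n1 p * A2 e p) *
          ((κ/2 * (F p 0 * A2 e p) - κ/2 * (F p 1 * A1 e p)) + 2 * τ * A3 e p)) U :=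
      ((((t1 e).mul q1).add ((t2 e).mul q2)).add ((t3 e).mul q3)).add
        (((s2.mul (t1 e)).sub (s1.mul (t2 e))).mul
          (((contDiffOn_const.mul ((sF 0).mul (t2 e))).sub
            (contDiffOn_const.mul ((sF 1).mul (t1 e)))).add (contDiffOn_const.mul (t3 e))))
    have den : ContDiffOn ℝ (⊤ : ℕ∞) (fun p =>
        A1 e p * A1 e p + A2 e p * A2 e p + A3 e p * A3 e p) U :=
      (((t1 e).mul (t1 e)).add ((t2 e).mul (t2 e))).add ((t3 e).mul (t3 e))
    refine (num.neg.div den haa).congr ?_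
    intro p hp
    obtain ⟨f1, f2, f3⟩ := fe e p hp
    simp only [Pi.neg_apply, Pi.div_apply]
    rw [eq_div_iff (haa p hp)]
    linear_combination (A1 e p) * f1 + (A2 e p) * f2 + (A3 e p) * f3
  have hnw : ∀ w, ∀ p ∈ U, n1 p * A1 w p + n2 p * A2 w p + n3 p * A3 w p = 0 := by
    intro w p hp
    rw [← hnt p hp w]
    simp only [n1, n2, n3, A1, A2, A3, r, bcvMetric, BCVProof.D_comp (dF p hp)]
    ring
  refine BCVProof.core κ τ hτ hκτ U hU hne e d (fun q => F q 0) (fun q => F q 1) (fun q => F q 2)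
    n1 n2 n3 (A1 e) (A2 e) (A3 e) (A1 d) (A2 d) (A3 d) lam (sF 0) (sF 1) (sF 2) s1 s2 s3
    (t1 e) (t2 e) (t3 e) (t1 d) (t2 d) (t3 d) sl
    (fun p hp => by rw [← hfx]; exact (hpos p hp).ne')
    (hx e) (hx d) (hy e) (hy d) (hz e) (hz d)
    (fun p hp => (fe e p hp).1) (fun p hp => (fe d p hp).1)
    (fun p hp => (fe e p hp).2.1) (fun p hp => (fe d p hp).2.1)
    (fun p hp => (fe e p hp).2.2) (fun p hp => (fe d p hp).2.2)
    ?_ (hnw e) (hnw d) hab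
  intro p hp
  rw [← hnn p hp]
  simp only [n1, n2, n3, r, bcvMetric]
  ring
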